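/- arXiv:1508.04428 — 3 statements merged into one kernel-verified Lean document; each statement's English description precedes it below -/
import Mathlib

section
/- Let ℒ be a distributive abstract logic. Then a theory P of ℒ is prime if and only if for all a, b ∈ Expr: a ∨ b ∈ P implies a ∈ P or b ∈ P. Moreover, every prime theory P satisfies: a ∨ b ∈ P iff (a ∈ P or b ∈ P), and a ∧ b ∈ P iff (a ∈ P and b ∈ P), for all a, b ∈ Expr. -/
/-- An abstract logic: a nonempty family of theories on `Expr`
closed under intersections of nonempty subfamilies. -/
def IsAbstractLogic {Expr : Type*} (Th : Set (Set Expr)) : Prop :=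
  Th.Nonempty ∧ ∀ 𝒯 ⊆ Th, 𝒯.Nonempty → ⋂₀ 𝒯 ∈ Th

/-- The logic is closed under chains: the union of every nonempty chain of
theories is a theory. -/
def ChainClosed {Expr : Type*} (Th : Set (Set Expr)) : Prop :=
  ∀ 𝒯 ⊆ Th, 𝒯.Nonempty → IsChain (· ⊆ ·) 𝒯 → ⋃₀ 𝒯 ∈ Th

/-- A theory is totally prime if whenever it is the intersection of a nonempty
family of theories, it belongs to that family. -/
def TotallyPrimeTheory {Expr : Type*} (Th : Set (Set Expr)) (T : Set Expr) : Prop :=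
  T ∈ Th ∧ ∀ 𝒯 ⊆ Th, 𝒯.Nonempty → T = ⋂₀ 𝒯 → T ∈ 𝒯

/-- A theory is prime if whenever it is the intersection of two theories,
it equals one of them. -/
def PrimeTheory {Expr : Type*} (Th : Set (Set Expr)) (T : Set Expr) : Prop :=
  T ∈ Th ∧ ∀ T₁ ∈ Th, ∀ T₂ ∈ Th, T = T₁ ∩ T₂ → T = T₁ ∨ T = T₂

/-- A distributive abstract logic: an abstract logic closed under chains with
binary operations `vee` (disjunction) and `wedge` (conjunction) behaving as
expected on all totally prime theories. -/
def IsDistributiveLogic {Expr : Type*} (Th : Set (Set Expr))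
    (vee wedge : Expr → Expr → Expr) : Prop :=
  IsAbstractLogic Th ∧ ChainClosed Th ∧
  (∀ T, TotallyPrimeTheory Th T → ∀ a b, vee a b ∈ T ↔ (a ∈ T ∨ b ∈ T)) ∧
  (∀ T, TotallyPrimeTheory Th T → ∀ a b, wedge a b ∈ T ↔ (a ∈ T ∧ b ∈ T))

/-- In a chain-closed logic, every theory omitting `a` extends to a totally prime theory
omitting `a`. -/
theorem ChainClosed.exists_totallyPrimeTheory {Expr : Type*} {Th : Set (Set Expr)}
    (hC : ChainClosed Th) {T : Set Expr} (hT : T ∈ Th) {a : Expr} (ha : a ∉ T) :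
    ∃ M, TotallyPrimeTheory Th M ∧ T ⊆ M ∧ a ∉ M := by
  obtain ⟨M, hTM, hM⟩ := zorn_subset_nonempty {S | S ∈ Th ∧ a ∉ S}
    (fun c hc hchain hne => ⟨⋃₀ c, ⟨hC c (fun S hS => (hc hS).1) hne hchain,
      fun ⟨S, hS, haS⟩ => (hc hS).2 haS⟩, fun S hS => Set.subset_sUnion_of_mem hS⟩)
    T ⟨hT, ha⟩
  refine ⟨M, ⟨hM.prop.1, fun 𝒯 h𝒯 _ hEq => ?_⟩, hTM, hM.prop.2⟩
  have haM : a ∉ ⋂₀ 𝒯 := hEq ▸ hM.prop.2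
  obtain ⟨S, hS, haS⟩ : ∃ S ∈ 𝒯, a ∉ S := by simpa using haM
  have hMS : M ⊆ S := hEq ▸ Set.sInter_subset_of_mem hS
  rwa [hM.eq_of_subset ⟨h𝒯 hS, haS⟩ hMS]

namespace IsDistributiveLogic

variable {Expr : Type*} {Th : Set (Set Expr)} {vee wedge : Expr → Expr → Expr}

theorem vee_mem (hD : IsDistributiveLogic Th vee wedge) {T : Set Expr} (hT : T ∈ Th)
    {a b : Expr} (h : a ∈ T ∨ b ∈ T) : vee a b ∈ T := by
  by_contra hv
  obtain ⟨M, hM, hTM, hvM⟩ := hD.2.1.exists_totallyPrimeTheory hT hv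
  exact hvM ((hD.2.2.1 M hM a b).2 (h.imp (@hTM a) (@hTM b)))

theorem wedge_mem_iff (hD : IsDistributiveLogic Th vee wedge) {T : Set Expr} (hT : T ∈ Th)
    {a b : Expr} : wedge a b ∈ T ↔ a ∈ T ∧ b ∈ T := by
  refine ⟨fun hw => ⟨?_, ?_⟩, fun h => ?_⟩ <;> by_contra hn <;>
    obtain ⟨M, hM, hTM, hnM⟩ := hD.2.1.exists_totallyPrimeTheory hT hn
  · exact hnM ((hD.2.2.2 M hM a b).1 (hTM hw)).1
  · exact hnM ((hD.2.2.2 M hM a b).1 (hTM hw)).2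
  · exact hnM ((hD.2.2.2 M hM a b).2 ⟨hTM h.1, hTM h.2⟩)

theorem mem_or_mem_of_primeTheory (hD : IsDistributiveLogic Th vee wedge) {P : Set Expr}
    (hP : PrimeTheory Th P) {a b : Expr} (hv : vee a b ∈ P) : a ∈ P ∨ b ∈ P := by
  by_contra! hab
  have key {x : Expr} (hx : x ∉ P) : ∃ M ∈ Th, P ⊆ M ∧ x ∉ M ∧ (a ∈ M ∨ b ∈ M) := by
    obtain ⟨M, hM, hPM, hxM⟩ := hD.2.1.exists_totallyPrimeTheory hP.1 hx
    exact ⟨M, hM.1, hPM, hxM, (hD.2.2.1 M hM a b).1 (hPM hv)⟩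
  let ext (x : Expr) : Set (Set Expr) := {T | T ∈ Th ∧ P ⊆ T ∧ x ∈ T}
  have hA : (ext a).Nonempty := by
    obtain ⟨M, hM, hPM, hbM, h⟩ := key hab.2
    exact ⟨M, hM, hPM, h.resolve_right hbM⟩
  have hB : (ext b).Nonempty := by
    obtain ⟨M, hM, hPM, haM, h⟩ := key hab.1
    exact ⟨M, hM, hPM, h.resolve_left haM⟩
  have hEq : P = ⋂₀ ext a ∩ ⋂₀ ext b := by
    refine Set.Subset.antisymm (Set.subset_inter (Set.subset_sInter fun T hT => hT.2.1)
      (Set.subset_sInter fun T hT => hT.2.1)) fun x hx => ?_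
    by_contra hxP
    obtain ⟨M, hM, hPM, hxM, h | h⟩ := key hxP
    · exact hxM (hx.1 M ⟨hM, hPM, h⟩)
    · exact hxM (hx.2 M ⟨hM, hPM, h⟩)
  rcases hP.2 _ (hD.1.2 (ext a) (fun T hT => hT.1) hA) _
    (hD.1.2 (ext b) (fun T hT => hT.1) hB) hEq with h | h
  · exact hab.1 (h ▸ Set.mem_sInter.2 fun T hT => hT.2.2)
  · exact hab.2 (h ▸ Set.mem_sInter.2 fun T hT => hT.2.2)

theorem primeTheory_of_forall_mem_or_mem (hD : IsDistributiveLogic Th vee wedge) {P : Set Expr}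
    (hP : P ∈ Th) (h : ∀ a b : Expr, vee a b ∈ P → a ∈ P ∨ b ∈ P) : PrimeTheory Th P := by
  refine ⟨hP, fun T₁ h₁ T₂ h₂ hEq => ?_⟩
  by_contra! hne
  have hP₁ : P ⊆ T₁ := hEq ▸ Set.inter_subset_left
  have hP₂ : P ⊆ T₂ := hEq ▸ Set.inter_subset_right
  obtain ⟨a, ha, haP⟩ := Set.exists_of_ssubset (hP₁.ssubset_of_ne hne.1)
  obtain ⟨b, hb, hbP⟩ := Set.exists_of_ssubset (hP₂.ssubset_of_ne hne.2)
  have hv : vee a b ∈ T₁ ∩ T₂ := ⟨hD.vee_mem h₁ (.inl ha), hD.vee_mem h₂ (.inr hb)⟩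
  exact (h a b (hEq ▸ hv)).elim haP hbP

end IsDistributiveLogic

/-- In a distributive abstract logic a theory is prime iff it is
stable under disjunction; moreover every prime theory satisfies the
disjunction and conjunction membership conditions. -/
theorem primeTheory_iff_disjunction {Expr : Type*} (Th : Set (Set Expr))
    (vee wedge : Expr → Expr → Expr) (hD : IsDistributiveLogic Th vee wedge) :
    (∀ P ∈ Th, (PrimeTheory Th P ↔ ∀ a b : Expr, vee a b ∈ P → a ∈ P ∨ b ∈ P)) ∧
    (∀ P, PrimeTheory Th P → ∀ a b : Expr,
      (vee a b ∈ P ↔ (a ∈ P ∨ b ∈ P)) ∧ (wedge a b ∈ P ↔ (a ∈ P ∧ b ∈ P))) := by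
  exact ⟨fun P hP => ⟨fun h _ _ => hD.mem_or_mem_of_primeTheory h,
      hD.primeTheory_of_forall_mem_or_mem hP⟩,
    fun P hP _ _ => ⟨⟨hD.mem_or_mem_of_primeTheory hP, hD.vee_mem hP.1⟩,
      hD.wedge_mem_iff hP.1⟩⟩
end

section
/- (Prime theory separation theorem.) Let ℒ be a distributive abstract logic, let T be a theory of ℒ, and let S ⊆ Expr be a nonempty set closed under disjunction (a ∈ S and b ∈ S imply a ∨ b ∈ S) such that T ∩ S = ∅. Then there exists a prime theory P of ℒ with T ⊆ P and P ∩ S = ∅. -/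
/-- In a chain-closed logic, every theory disjoint from `S` extends to a theory that is maximal
among those disjoint from `S`. -/
theorem ChainClosed.exists_maximal_disjoint {Expr : Type*} {Th : Set (Set Expr)}
    (hC : ChainClosed Th) {T S : Set Expr} (hT : T ∈ Th) (hTS : Disjoint T S) :
    ∃ M, T ⊆ M ∧ Maximal (fun U => U ∈ Th ∧ Disjoint U S) M := by
  refine zorn_subset_nonempty {U | U ∈ Th ∧ Disjoint U S} ?_ T ⟨hT, hTS⟩
  intro c hc hchain hne
  refine ⟨⋃₀ c, ⟨hC c (fun U hU => (hc hU).1) hne hchain, ?_⟩,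
    fun U hU => Set.subset_sUnion_of_mem hU⟩
  exact Set.disjoint_sUnion_left.2 fun U hU => (hc hU).2

/-- A theory that is maximal among those omitting a given expression is totally prime. -/
theorem totallyPrimeTheory_of_maximal {Expr : Type*} {Th : Set (Set Expr)} {M : Set Expr}
    {x : Expr} (hM : Maximal (fun U => U ∈ Th ∧ Disjoint U {x}) M) :
    TotallyPrimeTheory Th M := by
  refine ⟨hM.prop.1, fun 𝒯 h𝒯 _ hEq => ?_⟩
  have hx : x ∉ ⋂₀ 𝒯 := hEq ▸ Set.disjoint_singleton_right.1 hM.prop.2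
  obtain ⟨U, hU, hxU⟩ : ∃ U ∈ 𝒯, x ∉ U := by simpa using hx
  have hMU : M ⊆ U := hEq ▸ Set.sInter_subset_of_mem hU
  rwa [hM.eq_of_subset ⟨h𝒯 hU, Set.disjoint_singleton_right.2 hxU⟩ hMU]

/-- An expression belonging to every totally prime extension of a theory belongs to the theory. -/
theorem ChainClosed.mem_of_forall_totallyPrimeTheory {Expr : Type*} {Th : Set (Set Expr)}
    (hC : ChainClosed Th) {T : Set Expr} (hT : T ∈ Th) {x : Expr}
    (h : ∀ M, TotallyPrimeTheory Th M → T ⊆ M → x ∈ M) : x ∈ T := by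
  by_contra hx
  obtain ⟨M, hTM, hM⟩ := hC.exists_maximal_disjoint hT (Set.disjoint_singleton_right.2 hx)
  exact Set.disjoint_singleton_right.1 hM.prop.2 (h M (totallyPrimeTheory_of_maximal hM) hTM)

/-- Prime theory separation: if `T` is a theory and `S` a
nonempty set closed under disjunction with `T ∩ S = ∅`, then there is a prime
theory `P ⊇ T` with `P ∩ S = ∅`. -/
theorem prime_separation {Expr : Type*} (Th : Set (Set Expr))
    (vee wedge : Expr → Expr → Expr) (hD : IsDistributiveLogic Th vee wedge)
    (T : Set Expr) (hT : T ∈ Th) (S : Set Expr) (hS : S.Nonempty)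
    (hSvee : ∀ a ∈ S, ∀ b ∈ S, vee a b ∈ S) (hTS : T ∩ S = ∅) :
    ∃ P : Set Expr, PrimeTheory Th P ∧ T ⊆ P ∧ P ∩ S = ∅ := by
  obtain ⟨-, hC, hvee, -⟩ := hD
  obtain ⟨P, hTP, hP⟩ := hC.exists_maximal_disjoint hT (Set.disjoint_iff_inter_eq_empty.2 hTS)
  refine ⟨P, ⟨hP.prop.1, fun T₁ h₁ T₂ h₂ hEq => ?_⟩, hTP, hP.prop.2.inter_eq⟩
  by_contra! hne
  have meets : ∀ U ∈ Th, P ⊆ U → P ≠ U → ∃ a ∈ U, a ∈ S := fun U hU hPU hPne =>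
    Set.not_disjoint_iff.1 fun hUS => hPne (hP.eq_of_subset ⟨hU, hUS⟩ hPU)
  obtain ⟨a, ha, haS⟩ := meets T₁ h₁ (hEq ▸ Set.inter_subset_left) hne.1
  obtain ⟨b, hb, hbS⟩ := meets T₂ h₂ (hEq ▸ Set.inter_subset_right) hne.2
  have hab₁ : vee a b ∈ T₁ := hC.mem_of_forall_totallyPrimeTheory h₁ fun M hM hTM =>
    (hvee M hM a b).2 (Or.inl (hTM ha))
  have hab₂ : vee a b ∈ T₂ := hC.mem_of_forall_totallyPrimeTheory h₂ fun M hM hTM =>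
    (hvee M hM a b).2 (Or.inr (hTM hb))
  exact Set.disjoint_left.1 hP.prop.2 (hEq ▸ ⟨hab₁, hab₂⟩) (hSvee a haS b hbS)
end

section
/- A topological space X is spectral if and only if there exists a base Λ(X) making X a bounded distributive space; and in that case Λ(X) is exactly the set of all compact open subsets of X. In short, the bounded distributive spaces are precisely the spectral spaces. -/
/-- A prime filter on a family `Λ` of subsets (closed under binary unions and
intersections): a nonempty subset of `Λ` not containing `∅`, upward closed in
`(Λ, ⊆)`, closed under binary intersections, and prime for binary unions. -/
def IsPrimeFilter {X : Type*} (Λ : Set (Set X)) (F : Set (Set X)) : Prop :=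
  F.Nonempty ∧ F ⊆ Λ ∧ ∅ ∉ F ∧
  (∀ U ∈ F, ∀ V ∈ Λ, U ⊆ V → V ∈ F) ∧
  (∀ U ∈ F, ∀ V ∈ F, U ∩ V ∈ F) ∧
  (∀ U ∈ Λ, ∀ V ∈ Λ, U ∪ V ∈ F → U ∈ F ∨ V ∈ F)

/-- A distributive space: a T₀ space with a base `Λ` of compact open sets such
that `Λ ∪ {∅}` contains every compact open, `Λ` is closed under binary unions
and intersections, and every prime filter on `Λ` is of the form
`x^Λ = { U ∈ Λ | x ∈ U }` for some point `x`. -/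
def IsDistributiveSpace (X : Type*) [TopologicalSpace X] (Λ : Set (Set X)) : Prop :=
  T0Space X ∧ TopologicalSpace.IsTopologicalBasis Λ ∧
  (∀ U ∈ Λ, IsCompact U) ∧
  (∀ U : Set X, IsOpen U → IsCompact U → U ∈ Λ ∪ {∅}) ∧
  (∀ U ∈ Λ, ∀ V ∈ Λ, U ∪ V ∈ Λ) ∧
  (∀ U ∈ Λ, ∀ V ∈ Λ, U ∩ V ∈ Λ) ∧
  (∀ F, IsPrimeFilter Λ F → ∃ x : X, F = {U ∈ Λ | x ∈ U})

/-- A bounded distributive space additionally has `∅ ∈ Λ` and `X ∈ Λ`. -/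
def IsBoundedDistributiveSpace (X : Type*) [TopologicalSpace X] (Λ : Set (Set X)) : Prop :=
  IsDistributiveSpace X Λ ∧ ∅ ∈ Λ ∧ Set.univ ∈ Λ

/-- A spectral space: compact, T₀, the compact opens form a base closed under
finite (binary) intersections, and every nonempty irreducible closed subset
has a generic point (i.e. the space is quasi-sober). -/
def IsSpectral (X : Type*) [TopologicalSpace X] : Prop :=
  CompactSpace X ∧ T0Space X ∧
  TopologicalSpace.IsTopologicalBasis {U : Set X | IsOpen U ∧ IsCompact U} ∧
  (∀ U V : Set X, IsOpen U → IsCompact U → IsOpen V → IsCompact V →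
    IsOpen (U ∩ V) ∧ IsCompact (U ∩ V)) ∧
  QuasiSober X

open TopologicalSpace

section

variable {X : Type*} [TopologicalSpace X]

/-- The members of `Λ` meeting an irreducible set form a prime filter. -/
theorem isPrimeFilter_inter_nonempty {Λ : Set (Set X)} (hΛ : IsTopologicalBasis Λ)
    (hinter : ∀ U ∈ Λ, ∀ V ∈ Λ, U ∩ V ∈ Λ) {S : Set X} (hS : IsIrreducible S) :
    IsPrimeFilter Λ {U ∈ Λ | (S ∩ U).Nonempty} := by
  refine ⟨?_, fun U hU => hU.1, by simp, ?_, ?_, ?_⟩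
  · obtain ⟨s, hs⟩ := hS.1
    obtain ⟨U, hU, hsU, -⟩ := hΛ.exists_subset_of_mem_open (Set.mem_univ s) isOpen_univ
    exact ⟨U, hU, s, hs, hsU⟩
  · rintro U ⟨-, hU⟩ V hV hUV
    exact ⟨hV, hU.mono (Set.inter_subset_inter_right S hUV)⟩
  · rintro U ⟨hU, hSU⟩ V ⟨hV, hSV⟩
    exact ⟨hinter U hU V hV, hS.2 U V (hΛ.isOpen hU) (hΛ.isOpen hV) hSU hSV⟩
  · rintro U hU V hV ⟨-, h⟩
    rw [Set.inter_union_distrib_left, Set.union_nonempty] at h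
    exact h.imp (fun h => ⟨hU, h⟩) (fun h => ⟨hV, h⟩)

theorem quasiSober_of_isPrimeFilter {Λ : Set (Set X)} (hΛ : IsTopologicalBasis Λ)
    (hinter : ∀ U ∈ Λ, ∀ V ∈ Λ, U ∩ V ∈ Λ)
    (hpt : ∀ F, IsPrimeFilter Λ F → ∃ x : X, F = {U ∈ Λ | x ∈ U}) : QuasiSober X where
  sober {S} hS hSc := by
    obtain ⟨x, hx⟩ := hpt _ (isPrimeFilter_inter_nonempty hΛ hinter hS)
    have hx' : ∀ U ∈ Λ, (S ∩ U).Nonempty ↔ x ∈ U := fun U hU => by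
      simpa [hU] using Set.ext_iff.1 hx U
    refine ⟨x, Set.Subset.antisymm (closure_minimal (Set.singleton_subset_iff.2 ?_) hSc) ?_⟩
    · by_contra hxS
      obtain ⟨U, hU, hxU, hUS⟩ := hΛ.exists_subset_of_mem_open hxS hSc.isOpen_compl
      obtain ⟨s, hs, hsU⟩ := (hx' U hU).2 hxU
      exact hUS hsU hs
    · intro s hs
      refine hΛ.mem_closure_iff.2 fun U hU hsU => ?_
      exact ⟨x, (hx' U hU).1 ⟨s, hs, hsU⟩, rfl⟩

theorem IsPrimeFilter.exists_eq_of_quasiSober [QuasiSober X] {Λ F : Set (Set X)}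
    (hΛ : IsTopologicalBasis Λ) (hcompact : ∀ U ∈ Λ, IsCompact U) (hempty : ∅ ∈ Λ)
    (hunion : ∀ U ∈ Λ, ∀ V ∈ Λ, U ∪ V ∈ Λ) (hF : IsPrimeFilter Λ F) :
    ∃ x : X, F = {U ∈ Λ | x ∈ U} := by
  obtain ⟨⟨W, hW⟩, hsub, hne, hup, hcap, hprime⟩ := hF
  let S : Set X := {x | ∀ U ∈ Λ, x ∈ U → U ∈ F}
  have meets : ∀ U ∈ F, (S ∩ U).Nonempty := by
    intro K hK
    by_contra hdisj
    have hcover : ∃ V ∈ Λ, V ∉ F ∧ K ⊆ V := by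
      refine (hcompact K (hsub hK)).induction_on (p := fun s => ∃ V ∈ Λ, V ∉ F ∧ s ⊆ V)
        ⟨∅, hempty, hne, Set.Subset.rfl⟩ ?_ ?_ ?_
      · rintro s t hst ⟨V, hV, hVF, htV⟩
        exact ⟨V, hV, hVF, hst.trans htV⟩
      · rintro s t ⟨V, hV, hVF, hsV⟩ ⟨V', hV', hVF', htV⟩
        exact ⟨V ∪ V', hunion V hV V' hV',
          fun h => (hprime V hV V' hV' h).elim hVF hVF', Set.union_subset_union hsV htV⟩
      · intro x hx
        have hxS : x ∉ S := fun h => hdisj ⟨x, h, hx⟩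
        simp only [S, Set.mem_ofPred_eq, not_forall] at hxS
        obtain ⟨U, hU, hxU, hUF⟩ := hxS
        exact ⟨U, mem_nhdsWithin_of_mem_nhds ((hΛ.isOpen hU).mem_nhds hxU),
          U, hU, hUF, Set.Subset.rfl⟩
    obtain ⟨V, hV, hVF, hKV⟩ := hcover
    exact hVF (hup K hK V hV hKV)
  have hSc : IsClosed S := by
    rw [← isOpen_compl_iff, isOpen_iff_mem_nhds]
    intro x hx
    simp only [S, Set.mem_compl_iff, Set.mem_ofPred_eq, not_forall] at hx
    obtain ⟨U, hU, hxU, hUF⟩ := hx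
    exact Filter.mem_of_superset ((hΛ.isOpen hU).mem_nhds hxU)
      fun y hy hyS => hUF (hyS U hU hy)
  have hSi : IsIrreducible S := by
    refine ⟨(meets W hW).mono Set.inter_subset_left, ?_⟩
    rintro U V hU hV ⟨x, hxS, hxU⟩ ⟨y, hyS, hyV⟩
    obtain ⟨U', hU', hxU', hUU'⟩ := hΛ.exists_subset_of_mem_open hxU hU
    obtain ⟨V', hV', hyV', hVV'⟩ := hΛ.exists_subset_of_mem_open hyV hV
    exact (meets _ (hcap U' (hxS U' hU' hxU') V' (hyS V' hV' hyV'))).mono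
      (Set.inter_subset_inter_right S (Set.inter_subset_inter hUU' hVV'))
  obtain ⟨x, hx⟩ := QuasiSober.sober hSi hSc
  refine ⟨x, Set.ext fun U => ⟨fun hU => ⟨hsub hU, ?_⟩, fun hU => hx.mem U hU.1 hU.2⟩⟩
  exact (hx.mem_open_set_iff (hΛ.isOpen (hsub hU))).2 (meets U hU)

theorem IsSpectral.isBoundedDistributiveSpace (h : IsSpectral X) :
    IsBoundedDistributiveSpace X {U : Set X | IsOpen U ∧ IsCompact U} := by
  obtain ⟨_, hT0, hbasis, hinter, _⟩ := h
  have hunion : ∀ U ∈ {U : Set X | IsOpen U ∧ IsCompact U},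
      ∀ V ∈ {U : Set X | IsOpen U ∧ IsCompact U}, U ∪ V ∈ {U : Set X | IsOpen U ∧ IsCompact U} :=
    fun _ hU _ hV => ⟨hU.1.union hV.1, hU.2.union hV.2⟩
  exact ⟨⟨hT0, hbasis, fun _ hU => hU.2, fun _ hUo hUc => Or.inl ⟨hUo, hUc⟩, hunion,
    fun U hU V hV => hinter U V hU.1 hU.2 hV.1 hV.2,
    fun _ hF => hF.exists_eq_of_quasiSober hbasis (fun _ hU => hU.2)
      ⟨isOpen_empty, isCompact_empty⟩ hunion⟩,
    ⟨isOpen_empty, isCompact_empty⟩, isOpen_univ, isCompact_univ⟩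

theorem IsBoundedDistributiveSpace.eq_setOf_isOpen_isCompact {Λ : Set (Set X)}
    (h : IsBoundedDistributiveSpace X Λ) : Λ = {U : Set X | IsOpen U ∧ IsCompact U} := by
  obtain ⟨⟨-, hbasis, hcompact, hmem, -⟩, hempty, -⟩ := h
  refine Set.Subset.antisymm (fun U hU => ⟨hbasis.isOpen hU, hcompact U hU⟩) ?_
  rintro U ⟨hUo, hUc⟩
  rcases hmem U hUo hUc with hU | rfl
  exacts [hU, hempty]

theorem IsBoundedDistributiveSpace.isSpectral {Λ : Set (Set X)}
    (h : IsBoundedDistributiveSpace X Λ) : IsSpectral X := by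
  obtain rfl := h.eq_setOf_isOpen_isCompact
  obtain ⟨⟨hT0, hbasis, -, -, -, hinter, hpt⟩, -, huniv⟩ := h
  exact ⟨⟨huniv.2⟩, hT0, hbasis, fun U V hUo hUc hVo hVc => hinter U ⟨hUo, hUc⟩ V ⟨hVo, hVc⟩,
    quasiSober_of_isPrimeFilter hbasis hinter hpt⟩

end

/-- A topological space is spectral iff some base `Λ` makes it a
bounded distributive space, and in that case `Λ` is exactly the set of all
compact open subsets: the bounded distributive spaces are precisely the
spectral spaces. -/
theorem spectral_iff_bounded_distributive {X : Type*} [TopologicalSpace X] :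
    (IsSpectral X ↔ ∃ Λ : Set (Set X), IsBoundedDistributiveSpace X Λ) ∧
    (∀ Λ : Set (Set X), IsBoundedDistributiveSpace X Λ →
      Λ = {U : Set X | IsOpen U ∧ IsCompact U}) := by
  exact ⟨⟨fun h => ⟨_, h.isBoundedDistributiveSpace⟩, fun ⟨_, h⟩ => h.isSpectral⟩,
    fun _ h => h.eq_setOf_isOpen_isCompact⟩
end
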